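/- arXiv:2210.15580 — 2 statements merged into one kernel-verified Lean document; each statement's English description precedes it below -/
import Mathlib

section
/- Let g > 0 and ν ∈ ℝ, and let p(t) = e^{-gφ(t) - νt} with φ : [0,∞) → [0,∞) satisfying φ(0)=0, t ↦ φ(t)/t increasing, and φ(t)/t → ∞ as t → ∞. Then the map ν ↦ ‖Q(g,ν)‖ (operator norm of the integral operator with kernel k₀(t,s) = √(p(t))√(p(s)) e^{-t}e^{-s} I_0(2√(st)) on L²[0,∞)) is strictly decreasing in ν. -/
open MeasureTheory
open scoped Nat RealInnerProductSpace

noncomputable def besselI0 (z : ℝ) : ℝ :=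
  ∑' m : ℕ, (z / 2) ^ (2 * m) / (m ! * m !)

/-- The kernel k₀(t,s; g, ν) of the weakly self-avoiding walk transfer operator. -/
noncomputable def kernelK0 (phi : ℝ → ℝ) (g nu t s : ℝ) : ℝ :=
  Real.exp (-(g * phi t + nu * t) / 2) * Real.exp (-(g * phi s + nu * s) / 2) *
    Real.exp (-t) * Real.exp (-s) * besselI0 (2 * Real.sqrt (s * t))

theorem besselI0_term_nonneg (z : ℝ) (m : ℕ) : 0 ≤ (z / 2) ^ (2 * m) / ((m ! : ℝ) * m !) := by
  rw [pow_mul]; positivity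

theorem besselI0_term_le (z : ℝ) (m : ℕ) :
    (z / 2) ^ (2 * m) / ((m ! : ℝ) * m !) ≤ ((z / 2) ^ 2) ^ m / m ! := by
  rw [pow_mul]
  have h : (1 : ℝ) ≤ m ! := by exact_mod_cast Nat.one_le_iff_ne_zero.mpr (Nat.factorial_ne_zero m)
  gcongr
  nlinarith

theorem summable_besselI0_term (z : ℝ) :
    Summable fun m : ℕ => (z / 2) ^ (2 * m) / ((m ! : ℝ) * m !) :=
  Summable.of_nonneg_of_le (besselI0_term_nonneg z) (besselI0_term_le z)
    (Real.summable_pow_div_factorial _)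

theorem besselI0_le_exp (z : ℝ) : besselI0 z ≤ Real.exp ((z / 2) ^ 2) := by
  rw [Real.exp_eq_exp_ℝ, NormedSpace.exp_eq_tsum_div]
  exact (summable_besselI0_term z).tsum_le_tsum (besselI0_term_le z)
    (Real.summable_pow_div_factorial _)

theorem one_le_besselI0 (z : ℝ) : 1 ≤ besselI0 z := by
  have h := (summable_besselI0_term z).le_tsum 0 fun m _ => besselI0_term_nonneg z m
  simpa [besselI0] using h

theorem measurable_besselI0 : Measurable besselI0 := by
  have h : besselI0 = fun z => (∑' m : ℕ,
      ENNReal.ofReal ((z / 2) ^ (2 * m) / ((m ! : ℝ) * m !))).toReal := by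
    funext z
    rw [ENNReal.tsum_toReal_eq fun m => ENNReal.ofReal_ne_top]
    exact tsum_congr fun m => (ENNReal.toReal_ofReal (besselI0_term_nonneg z m)).symm
  rw [h]
  fun_prop

theorem kernelK0_nonneg (phi : ℝ → ℝ) (g nu t s : ℝ) : 0 ≤ kernelK0 phi g nu t s := by
  have h := one_le_besselI0 (2 * Real.sqrt (s * t))
  unfold kernelK0
  positivity

theorem kernelK0_le (phi : ℝ → ℝ) (hphi_nonneg : ∀ t : ℝ, 0 ≤ t → 0 ≤ phi t) (g : ℝ) (hg : 0 < g)
    (nu : ℝ) {t s : ℝ} (ht : t ∈ Set.Icc (0 : ℝ) 1) (hs : s ∈ Set.Icc (0 : ℝ) 1) :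
    kernelK0 phi g nu t s ≤ Real.exp (|nu| + 1) := by
  have hst : 0 ≤ s * t := mul_nonneg hs.1 ht.1
  have hexp : ∀ x ∈ Set.Icc (0 : ℝ) 1, -(g * phi x + nu * x) / 2 ≤ |nu| / 2 := fun x hx => by
    nlinarith [mul_nonneg hg.le (hphi_nonneg x hx.1), neg_abs_le nu, abs_nonneg nu, hx.1, hx.2]
  have hI : besselI0 (2 * Real.sqrt (s * t)) ≤ Real.exp (s * t) := by
    refine (besselI0_le_exp _).trans_eq ?_
    rw [mul_div_cancel_left₀ _ two_ne_zero, Real.sq_sqrt hst]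
  have hst1 : s * t ≤ 1 := mul_le_one₀ hs.2 ht.1 ht.2
  unfold kernelK0
  grw [hI]
  simp only [← Real.exp_add]
  apply Real.exp_le_exp.2
  linarith [hexp t ht, hexp s hs, ht.1, hs.1]

theorem le_kernelK0 (phi : ℝ → ℝ) {b : ℝ} (hb : ∀ t ∈ Set.Icc (0 : ℝ) 1, phi t ≤ b)
    (g : ℝ) (hg : 0 < g) (nu : ℝ) {t s : ℝ}
    (ht : t ∈ Set.Icc (0 : ℝ) 1) (hs : s ∈ Set.Icc (0 : ℝ) 1) :
    Real.exp (-(g * b + |nu| + 2)) ≤ kernelK0 phi g nu t s := by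
  have hexp : ∀ x ∈ Set.Icc (0 : ℝ) 1, -(g * b + |nu|) / 2 ≤ -(g * phi x + nu * x) / 2 :=
    fun x hx => by
      nlinarith [mul_le_mul_of_nonneg_left (hb x hx) hg.le, le_abs_self nu, abs_nonneg nu, hx.1,
        hx.2]
  unfold kernelK0
  grw [← one_le_besselI0]
  simp only [← Real.exp_add, mul_one]
  apply Real.exp_le_exp.2
  linarith [hexp t ht, hexp s hs, ht.2, hs.2]

theorem measurable_kernelK0 (phi : ℝ → ℝ) (hphi : Measurable phi) (g nu : ℝ) :
    Measurable (Function.uncurry (kernelK0 phi g nu)) := by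
  have := measurable_besselI0
  unfold kernelK0 Function.uncurry
  fun_prop

theorem kernelK0_eq_exp_mul (phi : ℝ → ℝ) (g a b t s : ℝ) :
    kernelK0 phi g b t s =
      Real.exp (-((b - a) * t) / 2) * Real.exp (-((b - a) * s) / 2) * kernelK0 phi g a t s := by
  have h : ∀ x, Real.exp (-(g * phi x + b * x) / 2) =
      Real.exp (-((b - a) * x) / 2) * Real.exp (-(g * phi x + a * x) / 2) := fun x => by
    rw [← Real.exp_add]; ring_nf
  unfold kernelK0
  rw [h t, h s]
  ring

theorem kernelK0_congr {phi psi : ℝ → ℝ} (g nu : ℝ) {t s : ℝ} (ht : phi t = psi t)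
    (hs : phi s = psi s) : kernelK0 phi g nu t s = kernelK0 psi g nu t s := by
  simp only [kernelK0, ht, hs]

theorem monotone_indicator_Ioi_of_monotoneOn_div {phi : ℝ → ℝ}
    (hphi_nonneg : ∀ t : ℝ, 0 ≤ t → 0 ≤ phi t)
    (hphi_mono : MonotoneOn (fun t => phi t / t) (Set.Ioi (0 : ℝ))) :
    Monotone ((Set.Ioi (0 : ℝ)).indicator phi) := by
  intro x y hxy
  by_cases hx : 0 < x
  · have hy : 0 < y := hx.trans_le hxy
    have h := hphi_mono hx hy hxy
    simp only [Set.indicator, Set.mem_Ioi, hx, hy, if_true]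
    have := div_nonneg (hphi_nonneg y hy.le) hy.le
    calc phi x = phi x / x * x := (div_mul_cancel₀ _ hx.ne').symm
      _ ≤ phi y / y * y := by gcongr
      _ = phi y := div_mul_cancel₀ _ hy.ne'
  · rw [Set.indicator_of_notMem (by simpa using hx)]
    exact Set.indicator_nonneg (fun t ht => hphi_nonneg t (le_of_lt ht)) y

section Lp

variable {α : Type*} [MeasurableSpace α] {μ : Measure α}

theorem Lp_norm_sq_eq_integral (f : Lp ℝ 2 μ) : ‖f‖ ^ 2 = ∫ t, f t ^ 2 ∂μ := by
  rw [← real_inner_self_eq_norm_sq, L2.inner_def]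
  simp [sq]

theorem exists_Lp_coeFn_eq_mul (f : Lp ℝ 2 μ) (w : α → ℝ) (hw : Measurable w)
    (hw1 : ∀ᵐ t ∂μ, |w t| ≤ 1) : ∃ h : Lp ℝ 2 μ, h =ᵐ[μ] fun t => w t * f t := by
  have hm : MemLp (fun t => w t * f t) 2 μ := by
    refine (Lp.memLp f).of_le
      (hw.aestronglyMeasurable.mul (Lp.aestronglyMeasurable f)) ?_
    filter_upwards [hw1] with t ht
    rw [norm_mul]
    exact mul_le_of_le_one_left (norm_nonneg _) ht
  exact ⟨hm.toLp _, hm.coeFn_toLp⟩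

/-- A kernel bounded by `C` on a set `S` induces a quadratic form bounded by `C * μ S` on
functions supported in `S`. -/
theorem abs_integral_integral_mul_le (K : α → α → ℝ) {S : Set α} (hS : MeasurableSet S)
    (hSfin : μ S ≠ ⊤) {C : ℝ} (hC : ∀ t ∈ S, ∀ s ∈ S, |K t s| ≤ C) (h : Lp ℝ 2 μ)
    (hh : ∀ᵐ t ∂μ, t ∉ S → h t = 0) :
    |∫ t, ∫ s, h t * h s * K t s ∂μ ∂μ| ≤ C * μ.real S * ‖h‖ ^ 2 := by
  have hsq := (Lp.memLp h).integrable_sq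
  have hind : Integrable (S.indicator fun _ => (1 : ℝ)) μ :=
    (integrable_indicator_iff hS).2 (integrableOn_const hSfin)
  have hindint : ∫ t, S.indicator (fun _ => (1 : ℝ)) t ∂μ = μ.real S := by
    simp [integral_indicator hS]
  have key : |∫ t, ∫ s, h t * h s * K t s ∂μ ∂μ| ≤
      ∫ t, C / 2 * (μ.real S * h t ^ 2 + S.indicator (fun _ => (1 : ℝ)) t * ‖h‖ ^ 2) ∂μ := by
    rw [← Real.norm_eq_abs]
    refine norm_integral_le_of_norm_le
      (((hsq.const_mul _).add (hind.mul_const _)).const_mul _) ?_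
    filter_upwards [hh] with t ht
    by_cases htS : t ∈ S
    · calc ‖∫ s, h t * h s * K t s ∂μ‖
          ≤ ∫ s, C / 2 * (S.indicator (fun _ => (1 : ℝ)) s * h t ^ 2 + h s ^ 2) ∂μ := by
            refine norm_integral_le_of_norm_le
              (((hind.mul_const _).add hsq).const_mul _) ?_
            filter_upwards [hh] with s hs
            by_cases hsS : s ∈ S
            · have hK := hC t htS s hsS
              rw [norm_mul, norm_mul, Real.norm_eq_abs, Real.norm_eq_abs, Real.norm_eq_abs,
                Set.indicator_of_mem hsS, ← sq_abs (h t), ← sq_abs (h s)]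
              have h2 : |h t| * |h s| ≤ (|h t| ^ 2 + |h s| ^ 2) / 2 := by
                nlinarith [sq_nonneg (|h t| - |h s|)]
              calc |h t| * |h s| * |K t s| ≤ (|h t| ^ 2 + |h s| ^ 2) / 2 * C := by gcongr
                _ = _ := by ring
            · simp [hs hsS, hsS]
        _ = _ := by
            rw [integral_const_mul, integral_add (hind.mul_const _) hsq, integral_mul_const,
              hindint, ← Lp_norm_sq_eq_integral, Set.indicator_of_mem htS, one_mul]
    · simp [ht htS, htS]
  refine key.trans_eq ?_
  rw [integral_const_mul, integral_add (hsq.const_mul _) (hind.mul_const _), integral_mul_const,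
    integral_const_mul, hindint, ← Lp_norm_sq_eq_integral]
  ring

/-- A measurable kernel bounded below by `c` on a set `S` has mean at least `c * (μ S)²` there. -/
theorem le_integral_integral_indicator [SFinite μ] (K : α → α → ℝ)
    (hK : Measurable (Function.uncurry K)) {S : Set α} (hS : MeasurableSet S)
    (hSfin : μ S ≠ ⊤) {c C : ℝ} (hc : ∀ t ∈ S, ∀ s ∈ S, c ≤ K t s)
    (hC : ∀ t ∈ S, ∀ s ∈ S, |K t s| ≤ C) :
    c * μ.real S ^ 2 ≤
      ∫ t, ∫ s, S.indicator (fun _ => (1 : ℝ)) t * S.indicator (fun _ => (1 : ℝ)) s * K t s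
        ∂μ ∂μ := by
  set e : α → ℝ := S.indicator fun _ => (1 : ℝ) with he
  have hem : Measurable e := measurable_const.indicator hS
  have hind : Integrable e μ := (integrable_indicator_iff hS).2 (integrableOn_const hSfin)
  have hindint : ∫ t, e t ∂μ = μ.real S := by simp [he, integral_indicator hS]
  have hHm : Measurable (Function.uncurry fun t s => e t * e s * K t s) := by
    have hK' : Measurable fun p : α × α => K p.1 p.2 := hK
    unfold Function.uncurry
    fun_prop
  have hlow : ∀ t s, c * e t * e s ≤ e t * e s * K t s := fun t s => by
    by_cases ht : t ∈ S <;> by_cases hs : s ∈ S <;> simp [he, ht, hs]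
    exact hc t ht s hs
  have hup : ∀ t s, ‖e t * e s * K t s‖ ≤ C * e t * e s := fun t s => by
    by_cases ht : t ∈ S <;> by_cases hs : s ∈ S <;> simp [he, ht, hs]
    exact hC t ht s hs
  have hinner : ∀ t, Integrable (fun s => e t * e s * K t s) μ := fun t =>
    (hind.const_mul (C * e t)).mono'
      (hHm.comp measurable_prodMk_left).aestronglyMeasurable (ae_of_all _ (hup t))
  have hup' : ∀ t, ‖∫ s, e t * e s * K t s ∂μ‖ ≤ C * e t * μ.real S := fun t => by
    rw [← hindint, ← integral_const_mul]
    exact norm_integral_le_of_norm_le (hind.const_mul _) (ae_of_all _ (hup t))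
  have hlow' : ∀ t, c * e t * μ.real S ≤ ∫ s, e t * e s * K t s ∂μ := fun t => by
    rw [← hindint, ← integral_const_mul]
    exact integral_mono (hind.const_mul _) (hinner t) (hlow t)
  have houter : Integrable (fun t => ∫ s, e t * e s * K t s ∂μ) μ :=
    ((hind.const_mul C).mul_const _).mono'
      hHm.stronglyMeasurable.integral_prod_right.aestronglyMeasurable (ae_of_all _ hup')
  calc c * μ.real S ^ 2 = ∫ t, c * e t * μ.real S ∂μ := by
        rw [integral_mul_const, integral_const_mul, hindint]; ring
    _ ≤ _ := integral_mono ((hind.const_mul c).mul_const _) houter hlow'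

end Lp

theorem ContinuousLinearMap.opNorm_le_of_abs_inner_le {E : Type*} [NormedAddCommGroup E]
    [InnerProductSpace ℝ E] [CompleteSpace E] (T : E →L[ℝ] E) (hT : IsSelfAdjoint T) {c : ℝ}
    (hc : 0 ≤ c) (h : ∀ x, |⟪T x, x⟫| ≤ c * ‖x‖ ^ 2) : ‖T‖ ≤ c := by
  rw [ContinuousLinearMap.norm_eq_iSup_rayleighQuotient T hT.isSymmetric]
  refine ciSup_le fun x => ?_
  rw [ContinuousLinearMap.rayleighQuotient, ContinuousLinearMap.reApplyInnerSelf_apply, abs_div,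
    abs_sq]
  exact div_le_of_le_mul₀ (sq_nonneg _) hc (h x)

/-- The quadratic form of `T` at `x + y` is controlled by the one at `x` when `y` is small. -/
theorem ContinuousLinearMap.abs_inner_add_le {E : Type*} [NormedAddCommGroup E]
    [InnerProductSpace ℝ E] (T : E →L[ℝ] E) (x y : E) :
    |⟪T (x + y), x + y⟫| ≤ |⟪T x, x⟫| + ‖T‖ * (‖x‖ + ‖x + y‖) * ‖y‖ := by
  have e : ⟪T (x + y), x + y⟫ = ⟪T x, x⟫ + (⟪T x, y⟫ + ⟪T y, x + y⟫) := by
    simp only [map_add, inner_add_left, inner_add_right]; ring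
  have h1 : |⟪T x, y⟫| ≤ ‖T‖ * ‖x‖ * ‖y‖ := by
    grw [abs_real_inner_le_norm, T.le_opNorm]
  have h2 : |⟪T y, x + y⟫| ≤ ‖T‖ * ‖y‖ * ‖x + y‖ := by
    grw [abs_real_inner_le_norm, T.le_opNorm]
  rw [e]
  grw [abs_add_le, abs_add_le ⟪T x, y⟫, h1, h2]
  exact le_of_eq (by ring)

/-- For fixed `g > 0`, the operator norm `ν ↦ ‖Q(g,ν)‖` is strictly decreasing in `ν`. -/
theorem opNorm_Q_strictAnti
    (phi : ℝ → ℝ) (hphi0 : phi 0 = 0)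
    (hphi_nonneg : ∀ t : ℝ, 0 ≤ t → 0 ≤ phi t)
    (hphi_mono : MonotoneOn (fun t => phi t / t) (Set.Ioi (0 : ℝ)))
    (hphi_super : Filter.Tendsto (fun t => phi t / t) Filter.atTop Filter.atTop)
    (g : ℝ) (hg : 0 < g)
    (Q : ℝ → (Lp ℝ 2 (volume.restrict (Set.Ici (0 : ℝ))) →L[ℝ]
      Lp ℝ 2 (volume.restrict (Set.Ici (0 : ℝ)))))
    (hQ_selfadj : ∀ nu : ℝ, IsSelfAdjoint (Q nu))
    (hQ_inner : ∀ (nu : ℝ) (f : Lp ℝ 2 (volume.restrict (Set.Ici (0 : ℝ)))),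
      ⟪Q nu f, f⟫ =
        ∫ t in Set.Ici (0 : ℝ), ∫ s in Set.Ici (0 : ℝ),
          f t * f s * kernelK0 phi g nu t s) :
    StrictAnti (fun nu => ‖Q nu‖) := by
  have hreal : ∀ r : ℝ, 0 ≤ r →
      (volume.restrict (Set.Ici (0 : ℝ))).real (Set.Icc 0 r) = r := fun r hr => by
    rw [measureReal_restrict_apply measurableSet_Icc,
      Set.inter_eq_left.2 fun x hx => hx.1, Real.volume_real_Icc_of_le hr, sub_zero]
  have hfin : ∀ r : ℝ, (volume.restrict (Set.Ici (0 : ℝ))) (Set.Icc 0 r) ≠ ⊤ := fun r =>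
    ((Measure.restrict_apply_le _ _).trans_lt measure_Icc_lt_top).ne
  have hae : ∀ᵐ t ∂(volume.restrict (Set.Ici (0 : ℝ))), 0 ≤ t :=
    ae_restrict_mem measurableSet_Ici
  have hCabs : ∀ nu, ∀ t ∈ Set.Icc (0 : ℝ) 1, ∀ s ∈ Set.Icc (0 : ℝ) 1,
      |kernelK0 phi g nu t s| ≤ Real.exp (|nu| + 1) := fun nu t ht s hs => by
    rw [abs_of_nonneg (kernelK0_nonneg phi g nu t s)]
    exact kernelK0_le phi hphi_nonneg g hg nu ht hs
  intro a b hab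
  have hpos : 0 < ‖Q a‖ := by
    set psi := (Set.Ioi (0 : ℝ)).indicator phi with hpsi_def
    have hpsi_mono : Monotone psi :=
      monotone_indicator_Ioi_of_monotoneOn_div hphi_nonneg hphi_mono
    have hpsi : ∀ t, 0 ≤ t → phi t = psi t := fun t ht => by
      rcases ht.eq_or_lt with rfl | ht
      · simp [hpsi_def, hphi0]
      · simp [hpsi_def, ht]
    have hcongr : ∀ t ∈ Set.Icc (0 : ℝ) 1, ∀ s ∈ Set.Icc (0 : ℝ) 1,
        kernelK0 phi g a t s = kernelK0 psi g a t s := fun t ht s hs =>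
      kernelK0_congr g a (hpsi t ht.1) (hpsi s hs.1)
    have hlow := le_integral_integral_indicator (μ := volume.restrict (Set.Ici (0 : ℝ)))
      (kernelK0 psi g a) (measurable_kernelK0 psi hpsi_mono.measurable g a)
      (measurableSet_Icc (a := (0 : ℝ)) (b := 1)) (hfin 1)
      (fun t ht s hs => le_kernelK0 psi (fun x hx => hpsi_mono hx.2) g hg a ht hs)
      (fun t ht s hs => hcongr t ht s hs ▸ hCabs a t ht s hs)
    rw [norm_pos_iff]
    intro hQ0
    have hq := hQ_inner a (indicatorConstLp 2 (measurableSet_Icc (a := (0 : ℝ)) (b := 1))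
      (hfin 1) (1 : ℝ))
    have hcoe := indicatorConstLp_coeFn (p := 2) (hs := measurableSet_Icc (a := (0 : ℝ)) (b := 1))
      (hμs := hfin 1) (c := (1 : ℝ))
    have heq : (∫ t in Set.Ici (0 : ℝ), ∫ s in Set.Ici (0 : ℝ),
          indicatorConstLp 2 (measurableSet_Icc (a := (0 : ℝ)) (b := 1)) (hfin 1) (1 : ℝ) t *
          indicatorConstLp 2 (measurableSet_Icc (a := (0 : ℝ)) (b := 1)) (hfin 1) (1 : ℝ) s *
          kernelK0 phi g a t s) =
        ∫ t in Set.Ici (0 : ℝ), ∫ s in Set.Ici (0 : ℝ),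
          (Set.Icc (0 : ℝ) 1).indicator (fun _ => (1 : ℝ)) t *
          (Set.Icc (0 : ℝ) 1).indicator (fun _ => (1 : ℝ)) s * kernelK0 psi g a t s := by
      refine integral_congr_ae ?_
      filter_upwards [hcoe, hae] with t ht ht0
      refine integral_congr_ae ?_
      filter_upwards [hcoe, hae] with s hs hs0
      rw [ht, hs, kernelK0_congr g a (hpsi t ht0) (hpsi s hs0)]
    rw [hQ0, heq, zero_apply, inner_zero_left] at hq
    rw [← hq, hreal 1 zero_le_one] at hlow
    have := Real.exp_pos (-(g * psi 1 + |a| + 2))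
    linarith
  set C := Real.exp (|a| + 1)
  have hCpos : 0 < C := Real.exp_pos _
  obtain ⟨r, hr0, hr1, hrC⟩ : ∃ r : ℝ, 0 < r ∧ r ≤ 1 ∧ C * r ≤ ‖Q a‖ / 4 :=
    ⟨min 1 (‖Q a‖ / 4 / C), by positivity, min_le_left _ _, by
      grw [min_le_right]; rw [mul_div_cancel₀ _ hCpos.ne']⟩
  have hd : 0 < b - a := sub_pos.2 hab
  obtain ⟨d, hd_def⟩ : ∃ d, d = Real.exp ((b - a) * r) - 1 := ⟨_, rfl⟩
  have hdpos : 0 < d := by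
    rw [hd_def, sub_pos, Real.one_lt_exp_iff]; positivity
  have hbound : ∀ f, |⟪Q b f, f⟫| ≤ max (3 / 4) (1 - d / 16) * ‖Q a‖ * ‖f‖ ^ 2 := by
    intro f
    obtain ⟨h, hh⟩ := exists_Lp_coeFn_eq_mul f (fun t => Real.exp (-((b - a) * t) / 2))
      (by fun_prop) (by
        filter_upwards [hae] with t ht
        rw [Real.abs_exp, Real.exp_le_one_iff]
        nlinarith [mul_nonneg hd.le ht])
    obtain ⟨h₁, hh₁⟩ := exists_Lp_coeFn_eq_mul h ((Set.Icc 0 r).indicator fun _ => (1 : ℝ))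
      (measurable_const.indicator measurableSet_Icc) (ae_of_all _ fun t => by
        by_cases ht : t ∈ Set.Icc 0 r <;> simp [ht])
    have hform : ⟪Q b f, f⟫ = ⟪Q a h, h⟫ := by
      rw [hQ_inner, hQ_inner]
      refine integral_congr_ae ?_
      filter_upwards [hh] with t ht
      refine integral_congr_ae ?_
      filter_upwards [hh] with s hs
      rw [ht, hs, kernelK0_eq_exp_mul phi g a b]
      ring
    have hh₁h : ‖h₁‖ ≤ ‖h‖ := by
      refine Lp.norm_le_norm_of_ae_le ?_
      filter_upwards [hh₁] with t ht
      rw [ht]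
      by_cases htS : t ∈ Set.Icc 0 r <;> simp [htS]
    have hnorm : ‖h‖ ^ 2 + d * ‖h - h₁‖ ^ 2 ≤ ‖f‖ ^ 2 := by
      simp only [Lp_norm_sq_eq_integral]
      rw [← integral_const_mul, ← integral_add (Lp.memLp h).integrable_sq
        ((Lp.memLp (h - h₁)).integrable_sq.const_mul _)]
      refine integral_mono_ae ((Lp.memLp h).integrable_sq.add
        ((Lp.memLp (h - h₁)).integrable_sq.const_mul _)) (Lp.memLp f).integrable_sq ?_
      filter_upwards [hh, hh₁, hae, Lp.coeFn_sub h h₁] with t ht ht₁ ht0 hsub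
      have hft : f t ^ 2 = Real.exp ((b - a) * t) * h t ^ 2 := by
        rw [ht, mul_pow, ← Real.exp_nat_mul, ← mul_assoc, ← Real.exp_add]
        ring_nf
        simp
      rw [hsub, Pi.sub_apply, ht₁, hft]
      by_cases htr : t ≤ r
      · rw [Set.indicator_of_mem (Set.mem_Icc.2 ⟨ht0, htr⟩)]
        have : 1 ≤ Real.exp ((b - a) * t) := Real.one_le_exp (mul_nonneg hd.le ht0)
        nlinarith [sq_nonneg (h t)]
      · rw [Set.indicator_of_notMem fun hm => htr hm.2]
        have : d + 1 ≤ Real.exp ((b - a) * t) := by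
          rw [hd_def, sub_add_cancel]
          exact Real.exp_le_exp.2 (mul_le_mul_of_nonneg_left (not_le.1 htr).le hd.le)
        nlinarith [sq_nonneg (h t)]
    have hhf : ‖h‖ ≤ ‖f‖ := by
      refine (sq_le_sq₀ (norm_nonneg _) (norm_nonneg _)).1 ?_
      nlinarith [sq_nonneg ‖h - h₁‖]
    rw [hform]
    rcases le_total ‖h - h₁‖ (‖f‖ / 4) with hsmall | hlarge
    · have h1 : |⟪Q a h₁, h₁⟫| ≤ ‖Q a‖ / 4 * ‖f‖ ^ 2 := by
        have hloc := abs_integral_integral_mul_le (μ := volume.restrict (Set.Ici (0 : ℝ)))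
          (kernelK0 phi g a) (measurableSet_Icc (a := (0 : ℝ)) (b := r)) (hfin r) (C := C)
          (fun t ht s hs => hCabs a t ⟨ht.1, ht.2.trans hr1⟩ s ⟨hs.1, hs.2.trans hr1⟩) h₁ (by
            filter_upwards [hh₁] with t ht htS
            simp [ht, htS])
        rw [← hQ_inner, hreal r hr0.le] at hloc
        grw [hloc, hrC, hh₁h, hhf]
      have h2 := (Q a).abs_inner_add_le h₁ (h - h₁)
      rw [add_sub_cancel] at h2
      grw [h2, h1, hh₁h, hhf, hsmall, ← le_max_left]
      exact le_of_eq (by ring)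
    · have h1 : |⟪Q a h, h⟫| ≤ ‖Q a‖ * ‖h‖ ^ 2 := by
        grw [abs_real_inner_le_norm, (Q a).le_opNorm]
        exact le_of_eq (by ring)
      have h2 : (‖f‖ / 4) ^ 2 ≤ ‖h - h₁‖ ^ 2 := by gcongr
      have h3 : ‖h‖ ^ 2 ≤ (1 - d / 16) * ‖f‖ ^ 2 := by nlinarith
      grw [h1, h3, ← le_max_right]
      exact le_of_eq (by ring)
  have hmax : max (3 / 4) (1 - d / 16) < 1 := max_lt (by norm_num) (by linarith)
  calc ‖Q b‖ ≤ max (3 / 4) (1 - d / 16) * ‖Q a‖ :=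
        (Q b).opNorm_le_of_abs_inner_le (hQ_selfadj b) (by positivity) hbound
    _ < ‖Q a‖ := mul_lt_of_lt_one_left hpos hmax
end

section
/- (Tauberian theorem, k = 0 case.) Let f : [0,∞) → [0,∞) be differentiable with f' = α₊ − α₋ where α₊, α₋ ≥ 0. Suppose the Laplace transforms Lf, Lα₊, Lα₋ converge for Re z > 0 and extend meromorphically to an open set containing {Re z ≥ 0}, that Lf has a unique simple pole at z = 0 and each Lα± has at most a simple pole at z = 0, and that lim_{z→0} z·Lf(z) = C > 0. Then lim_{T→∞} f(T) = C. -/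
open MeasureTheory Filter

section
open Set Complex
open scoped FourierTransform Topology Convolution ContDiff

/-- A nonnegative kernel of total mass one with finite first moment whose inverse Fourier
transform `k` is continuous and compactly supported. -/
structure IsBandlimitedKernel (k : ℝ → ℂ) (K : ℝ → ℝ) : Prop where
  continuous_symbol : Continuous k
  hasCompactSupport_symbol : HasCompactSupport k
  fourier_symbol : ∀ v, 𝓕 k v = K v
  nonneg : ∀ v, 0 ≤ K v
  continuous : Continuous K
  integrable : Integrable K
  integrable_abs_mul : Integrable fun v => |v| * K v
  integral_eq_one : ∫ v, K v = 1

namespace IsBandlimitedKernel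

theorem integrable_symbol {k : ℝ → ℂ} {K : ℝ → ℝ} (hK : IsBandlimitedKernel k K) :
    Integrable k :=
  hK.continuous_symbol.integrable_of_hasCompactSupport hK.hasCompactSupport_symbol

theorem le_integral_norm {k : ℝ → ℂ} {K : ℝ → ℝ} (hK : IsBandlimitedKernel k K) (v : ℝ) :
    K v ≤ ∫ y, ‖k y‖ := by
  have h : ‖𝓕 k v‖ ≤ ∫ y, ‖k y‖ := by
    rw [Real.fourier_real_eq]
    refine (norm_integral_le_integral_norm _).trans (le_of_eq ?_)
    simp
  rw [hK.fourier_symbol] at h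
  simpa [abs_of_nonneg (hK.nonneg v)] using h

/-- The dilation `v ↦ r K(r v)` of a bandlimited kernel. -/
theorem dilate {k : ℝ → ℂ} {K : ℝ → ℝ} (hK : IsBandlimitedKernel k K) {r : ℝ} (hr : 0 < r) :
    IsBandlimitedKernel (fun y => k (r⁻¹ * y)) (fun v => r * K (r * v)) where
  continuous_symbol := hK.continuous_symbol.comp (by fun_prop)
  hasCompactSupport_symbol :=
    hK.hasCompactSupport_symbol.comp_homeomorph (Homeomorph.mulLeft₀ r⁻¹ (by positivity))
  fourier_symbol v := by
    have h := Measure.integral_comp_mul_left (fun y => 𝐞 (-(y * (r * v))) • k y) r⁻¹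
    rw [← Real.fourier_real_eq, hK.fourier_symbol] at h
    rw [Real.fourier_real_eq]
    calc _ = _ := integral_congr_ae (.of_forall fun y => ?_)
      _ = _ := h
      _ = _ := ?_
    · congr 3
      field_simp
    · rw [inv_inv, abs_of_pos hr]
      push_cast
      simp
  nonneg v := mul_nonneg hr.le (hK.nonneg _)
  continuous := continuous_const.mul (hK.continuous.comp (by fun_prop))
  integrable := (hK.integrable.comp_mul_left' hr.ne').const_mul r
  integrable_abs_mul := by
    refine (hK.integrable_abs_mul.comp_mul_left' hr.ne').congr (.of_forall fun v => ?_)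
    simp only [abs_mul, abs_of_pos hr]
    ring
  integral_eq_one := by
    rw [integral_const_mul, Measure.integral_comp_mul_left, hK.integral_eq_one, smul_eq_mul,
      abs_of_pos (by positivity)]
    field_simp

theorem integral_abs_mul_dilate (K : ℝ → ℝ) {r : ℝ} (hr : 0 < r) :
    ∫ v, |v| * (r * K (r * v)) = r⁻¹ * ∫ v, |v| * K v := by
  have h := Measure.integral_comp_mul_left (fun v => |v| * K v) r
  rw [smul_eq_mul, abs_of_pos (by positivity)] at h
  rw [← h]
  refine integral_congr_ae (.of_forall fun v => ?_)
  simp only [abs_mul, abs_of_pos hr]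
  ring

theorem exists_kernel : ∃ k K, IsBandlimitedKernel k K := by
  let b : ContDiffBump (0 : ℝ) := ⟨1, 2, one_pos, one_lt_two⟩
  let φ : ℝ → ℂ := fun y => (b y : ℂ)
  have hφs : HasCompactSupport φ := b.hasCompactSupport.comp_left ofReal_zero
  have hφd : ContDiff ℝ ∞ φ := ofRealCLM.contDiff.comp b.contDiff
  have hφi : Integrable φ := hφd.continuous.integrable_of_hasCompactSupport hφs
  let ψ := 𝓕 (hφs.toSchwartzMap hφd)
  have hψ : ∀ v, ψ v = 𝓕 φ v := fun v => rfl
  have hψ_conj : ∀ v, (starRingEnd ℂ) (ψ v) = ψ v := by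
    intro v
    rw [hψ, Real.fourier_real_eq, ← integral_conj, ← integral_neg_eq_self]
    refine integral_congr_ae (.of_forall fun y => ?_)
    simp only [Circle.smul_def, smul_eq_mul, map_mul, φ, conj_ofReal, b.neg]
    rw [← Circle.coe_inv_eq_conj, ← AddChar.map_neg_eq_inv]
    simp
  have hsq : ∀ v, ψ v * ψ v = ((‖ψ v‖ ^ 2 : ℝ) : ℂ) := by
    intro v
    rw [← Complex.normSq_eq_norm_sq, Complex.normSq_eq_conj_mul_self, hψ_conj]
  obtain ⟨D, -, hD⟩ := ψ.decay 0 0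
  simp only [pow_zero, one_mul, norm_iteratedFDeriv_zero] at hD
  have hint : ∀ n : ℕ, Integrable fun v : ℝ => |v| ^ n * ‖ψ v‖ ^ 2 := by
    intro n
    refine ((ψ.integrable_pow_mul volume n).const_mul D).mono'
      (by fun_prop) (.of_forall fun v => ?_)
    rw [Real.norm_eq_abs, abs_of_nonneg (by positivity), Real.norm_eq_abs]
    nlinarith [mul_le_mul_of_nonneg_left (hD v) (by positivity : 0 ≤ |v| ^ n * ‖ψ v‖)]
  have hi0 : Integrable fun v : ℝ => ‖ψ v‖ ^ 2 := by simpa using hint 0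
  have hpos : 0 < ∫ v, ‖ψ v‖ ^ 2 := by
    refine integral_pos_of_integrable_nonneg_nonzero (x := 0) (by fun_prop) hi0
      (fun v => by positivity) ?_
    have h0 : ψ 0 = ((∫ y, b y : ℝ) : ℂ) := by
      rw [hψ, Real.fourier_real_eq, ← integral_complex_ofReal]
      simp [φ]
    rw [h0]
    have := b.integral_pos (μ := volume)
    simp [this.ne']
  have hkc : Continuous (φ ⋆[ContinuousLinearMap.mul ℂ ℂ] φ) :=
    hφs.continuous_convolution_left _ hφd.continuous hφi.locallyIntegrable
  have hks : HasCompactSupport (φ ⋆[ContinuousLinearMap.mul ℂ ℂ] φ) := hφs.convolution _ hφs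
  set c : ℝ := ∫ v, ‖ψ v‖ ^ 2
  refine ⟨fun y => (c⁻¹ : ℂ) * (φ ⋆[ContinuousLinearMap.mul ℂ ℂ] φ) y, fun v => c⁻¹ * ‖ψ v‖ ^ 2,
    ⟨?_, ?_, ?_, ?_, ?_, ?_, ?_, ?_⟩⟩
  · exact continuous_const.mul hkc
  · exact hks.mul_left
  · intro v
    have h := Real.fourier_mul_convolution_eq hφi hφi v
    rw [Real.fourier_real_eq] at h ⊢
    rw [← hψ, hsq] at h
    push_cast at h ⊢
    rw [← h, ← integral_const_mul]
    refine integral_congr_ae (.of_forall fun y => ?_)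
    simp only [Circle.smul_def, smul_eq_mul]
    ring
  · intro v; positivity
  · fun_prop
  · exact hi0.const_mul _
  · refine ((hint 1).const_mul c⁻¹).congr (.of_forall fun v => ?_)
    simp only; ring
  · rw [integral_const_mul]
    exact inv_mul_cancel₀ hpos.ne'

end IsBandlimitedKernel

/-- The function `u` on `[0, ∞)` has a Laplace transform converging on `Re z > 0` which is the
restriction of a function `H` continuous on the closed half-plane. -/
structure HasLaplaceExtension (u : ℝ → ℝ) (H : ℂ → ℂ) : Prop where
  integrableOn : ∀ z : ℂ, 0 < z.re →
    IntegrableOn (fun T : ℝ => (u T : ℂ) * exp (-z * T)) (Ici (0 : ℝ))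
  continuousOn : ContinuousOn H {z | 0 ≤ z.re}
  eq_integral : ∀ z : ℂ, 0 < z.re → H z = ∫ T in Ici (0 : ℝ), (u T : ℂ) * exp (-z * T)

theorem ofReal_integrableOn_mul_exp {u : ℝ → ℝ} {x : ℝ}
    (h : IntegrableOn (fun T : ℝ => (u T : ℂ) * exp (-(x : ℂ) * T)) (Ici (0 : ℝ))) :
    IntegrableOn (fun T : ℝ => u T * Real.exp (-x * T)) (Ici (0 : ℝ)) := by
  refine h.re.congr (.of_forall fun T => ?_)
  simp only [← ofReal_neg, ← ofReal_mul, ← ofReal_exp]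
  rfl

theorem aestronglyMeasurable_of_integrableOn_mul_exp {u : ℝ → ℝ} {x : ℝ}
    (h : IntegrableOn (fun T : ℝ => u T * Real.exp (-x * T)) (Ici (0 : ℝ))) :
    AEStronglyMeasurable u (volume.restrict (Ici 0)) := by
  have h2 : AEStronglyMeasurable (fun T : ℝ => Real.exp (x * T)) (volume.restrict (Ici 0)) :=
    Continuous.aestronglyMeasurable (by fun_prop)
  refine (h.aestronglyMeasurable.mul h2).congr (.of_forall fun T => ?_)
  simp only [Pi.mul_apply]
  rw [mul_assoc, ← Real.exp_add]
  simp

namespace HasLaplaceExtension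

variable {u : ℝ → ℝ} {H : ℂ → ℂ} {k : ℝ → ℂ} {K : ℝ → ℝ}

theorem integrableOn_mul_exp (hu : HasLaplaceExtension u H) {x : ℝ} (hx : 0 < x) :
    IntegrableOn (fun T : ℝ => u T * Real.exp (-x * T)) (Ici (0 : ℝ)) :=
  ofReal_integrableOn_mul_exp (hu.integrableOn x (by simpa using hx))

theorem aestronglyMeasurable (hu : HasLaplaceExtension u H) :
    AEStronglyMeasurable u (volume.restrict (Ici 0)) :=
  aestronglyMeasurable_of_integrableOn_mul_exp (hu.integrableOn_mul_exp one_pos)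

theorem integrableOn_mul_exp_mul_kernel (hu : HasLaplaceExtension u H)
    (hK : IsBandlimitedKernel k K) {x : ℝ} (hx : 0 < x) (T : ℝ) :
    IntegrableOn (fun t : ℝ => u t * Real.exp (-x * t) * K (T - t)) (Ici (0 : ℝ)) :=
  (hu.integrableOn_mul_exp hx).mul_bdd (c := ∫ y, ‖k y‖)
    (hK.continuous.comp (by fun_prop)).aestronglyMeasurable
    (.of_forall fun t => by
      rw [Real.norm_eq_abs, abs_of_nonneg (hK.nonneg _)]; exact hK.le_integral_norm _)

theorem integral_mul_exp_mul_kernel (hu : HasLaplaceExtension u H)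
    (hK : IsBandlimitedKernel k K) {x : ℝ} (hx : 0 < x) (T : ℝ) :
    ((∫ t in Ici (0 : ℝ), u t * Real.exp (-x * t) * K (T - t) : ℝ) : ℂ) =
      𝓕 (fun y : ℝ => k y * H (x - 2 * Real.pi * y * I)) T := by
  have hre : ∀ y : ℝ, 0 < ((x : ℂ) - 2 * Real.pi * y * I).re := by intro y; simpa using hx
  have hexp : ∀ y t : ℝ, 𝐞 (-(y * T)) • (k y * ((u t : ℂ) * exp (-(x - 2 * Real.pi * y * I) * t)))
      = ((u t * Real.exp (-x * t) : ℝ) : ℂ) * 𝐞 (-(y * (T - t))) • k y := by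
    intro y t
    have : exp (-(x - 2 * Real.pi * y * I) * t) =
        exp (-x * t) * exp (((2 * Real.pi * (y * t) : ℝ) : ℂ) * I) := by
      rw [← exp_add]; push_cast; ring_nf
    have h2 : 𝐞 (-(y * (T - t))) = 𝐞 (-(y * T)) * 𝐞 (y * t) := by
      rw [← AddChar.map_add_eq_mul]; ring_nf
    rw [this, h2, ← Real.fourierChar_apply]
    simp only [Circle.smul_def, smul_eq_mul, Circle.coe_mul]
    push_cast
    ring
  rw [Real.fourier_real_eq]
  calc _ = ∫ t in Ici (0 : ℝ), ∫ y,
        ((u t * Real.exp (-x * t) : ℝ) : ℂ) * 𝐞 (-(y * (T - t))) • k y := by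
        rw [← integral_complex_ofReal]
        refine integral_congr_ae (.of_forall fun t => ?_)
        simp only
        rw [integral_const_mul, ← Real.fourier_real_eq, hK.fourier_symbol, ofReal_mul]
    _ = ∫ y, ∫ t in Ici (0 : ℝ),
        ((u t * Real.exp (-x * t) : ℝ) : ℂ) * 𝐞 (-(y * (T - t))) • k y := by
        refine integral_integral_swap ?_
        have h := (hu.integrableOn_mul_exp hx).ofReal (𝕜 := ℂ) |>.mul_prod hK.integrable_symbol
        refine h.mono ?_ (.of_forall fun p => ?_)
        · have hc : Continuous fun p : ℝ × ℝ => (𝐞 (-(p.2 * (T - p.1))) : ℂ) := by fun_prop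
          refine (hc.aestronglyMeasurable.mul h.aestronglyMeasurable).congr
            (.of_forall fun p => ?_)
          simp only [Function.uncurry, Circle.smul_def, smul_eq_mul, Pi.mul_apply, coe_algebraMap]
          ring_nf
        · simp [Function.uncurry]
    _ = _ := by
        refine integral_congr_ae (.of_forall fun y => ?_)
        simp only
        rw [hu.eq_integral _ (hre y), ← integral_const_mul, Circle.smul_def, smul_eq_mul,
          ← integral_const_mul]
        refine integral_congr_ae (.of_forall fun t => ?_)
        simp only
        rw [← hexp, Circle.smul_def, smul_eq_mul]

theorem exists_norm_le (hu : HasLaplaceExtension u H) (hK : IsBandlimitedKernel k K) :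
    ∃ M, ∀ x ∈ Icc (0 : ℝ) 1, ∀ y : ℝ, ‖k y * H (x - 2 * Real.pi * y * I)‖ ≤ ‖k y‖ * M := by
  have hc : ContinuousOn (fun p : ℝ × ℝ => H (p.1 - 2 * Real.pi * p.2 * I))
      (Icc (0 : ℝ) 1 ×ˢ tsupport k) := by
    refine hu.continuousOn.comp (by fun_prop) fun p hp => ?_
    simpa using hp.1.1
  obtain ⟨M, hM⟩ :=
    (isCompact_Icc.prod hK.hasCompactSupport_symbol.isCompact).exists_bound_of_continuousOn hc
  refine ⟨M, fun x hx y => ?_⟩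
  by_cases hy : y ∈ tsupport k
  · rw [norm_mul]
    exact mul_le_mul_of_nonneg_left (hM (x, y) ⟨hx, hy⟩) (norm_nonneg _)
  · simp [image_eq_zero_of_notMem_tsupport hy]

theorem integrableOn_mul_kernel (hu : HasLaplaceExtension u H) (hK : IsBandlimitedKernel k K)
    {A B : ℝ} (hA : 0 ≤ A) (hB : 0 ≤ B) (hbound : ∀ t, 0 ≤ t → -(A + B * t) ≤ u t) (T : ℝ) :
    IntegrableOn (fun t => u t * K (T - t)) (Ici 0) := by
  obtain ⟨M, hM⟩ := hu.exists_norm_le hK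
  have hKT : Integrable fun t => K (T - t) := hK.integrable.comp_sub_left T
  have hKT' : Integrable fun t => |T - t| * K (T - t) := hK.integrable_abs_mul.comp_sub_left T
  have hlin : IntegrableOn (fun t => (A + B * t) * K (T - t)) (Ici 0) := by
    refine Integrable.mono' (((hKT.const_mul (A + B * |T|)).add (hKT'.const_mul B)).restrict)
      (((by fun_prop : Continuous fun t => A + B * t).mul
        (hK.continuous.comp (by fun_prop))).aestronglyMeasurable)
      ((ae_restrict_mem measurableSet_Ici).mono fun t (ht : 0 ≤ t) => ?_)
    have h0 := hK.nonneg (T - t)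
    rw [norm_mul, Real.norm_eq_abs, Real.norm_eq_abs, abs_of_nonneg h0,
      abs_of_nonneg (by positivity : 0 ≤ A + B * t)]
    have h1 : t ≤ |T| + |T - t| := by linarith [le_abs_self T, neg_abs_le (T - t)]
    simp only [Pi.add_apply]
    nlinarith [mul_le_mul_of_nonneg_right (mul_le_mul_of_nonneg_left h1 hB) h0]
  have hpos : ∀ n : ℕ, 0 < 1 / ((n : ℝ) + 1) := fun n => Nat.one_div_pos_of_nat
  have hle : ∀ n : ℕ, 1 / ((n : ℝ) + 1) ≤ 1 := fun n => by
    rw [div_le_one (by positivity)]; linarith [n.cast_nonneg (α := ℝ)]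
  let G : ℕ → ℝ → ℝ := fun n t =>
    (u t + (A + B * t)) * Real.exp (-(1 / ((n : ℝ) + 1)) * t) * K (T - t)
  have hexp_le : ∀ n : ℕ, ∀ t, 0 ≤ t → Real.exp (-(1 / ((n : ℝ) + 1)) * t) ≤ 1 := fun n t ht => by
    rw [Real.exp_le_one_iff]; nlinarith [hpos n]
  have hlin_exp : ∀ n : ℕ, IntegrableOn
      (fun t => (A + B * t) * K (T - t) * Real.exp (-(1 / ((n : ℝ) + 1)) * t)) (Ici 0) := fun n => by
    refine Integrable.mul_bdd (c := 1) hlin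
      (Continuous.aestronglyMeasurable (by fun_prop))
      ((ae_restrict_mem measurableSet_Ici).mono fun t ht => ?_)
    rw [Real.norm_eq_abs, Real.abs_exp]
    exact hexp_le n t ht
  have hu_exp := fun n => hu.integrableOn_mul_exp_mul_kernel hK (hpos n) T
  have hG_eq : ∀ n, G n = fun t => u t * Real.exp (-(1 / ((n : ℝ) + 1)) * t) * K (T - t) +
      (A + B * t) * K (T - t) * Real.exp (-(1 / ((n : ℝ) + 1)) * t) := fun n => by
    funext t; simp only [G]; ring
  have hG_int : ∀ n, IntegrableOn (G n) (Ici 0) := fun n => by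
    rw [hG_eq]; exact (hu_exp n).add (hlin_exp n)
  have hG_nonneg : ∀ n t, 0 ≤ t → 0 ≤ G n t := fun n t ht => by
    have := hbound t ht
    exact mul_nonneg (mul_nonneg (by linarith) (Real.exp_pos _).le) (hK.nonneg _)
  have hG_le : ∀ n, ∫ t in Ici 0, G n t ≤
      (∫ y, ‖k y‖ * M) + ∫ t in Ici (0 : ℝ), (A + B * t) * K (T - t) := fun n => by
    rw [hG_eq, integral_add (hu_exp n) (hlin_exp n)]
    refine add_le_add ?_ ?_
    · have h := hu.integral_mul_exp_mul_kernel hK (hpos n) T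
      refine (le_abs_self _).trans ?_
      rw [← Real.norm_eq_abs, ← Complex.norm_real, h, Real.fourier_real_eq]
      refine norm_integral_le_of_norm_le (hK.integrable_symbol.norm.mul_const M)
        (.of_forall fun y => ?_)
      rw [Circle.norm_smul]
      exact hM _ ⟨(hpos n).le, hle n⟩ y
    · refine setIntegral_mono_on (hlin_exp n) hlin measurableSet_Ici fun t ht => ?_
      have ht : 0 ≤ t := ht
      exact mul_le_of_le_one_right (mul_nonneg (by positivity) (hK.nonneg _)) (hexp_le n t ht)
  have key : IntegrableOn (fun t => (u t + (A + B * t)) * K (T - t)) (Ici 0) := by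
    refine integrable_of_tendsto (G := G) (.of_forall fun t => ?_)
      (fun n => (hG_int n).aestronglyMeasurable) ?_
    · have h1 : Tendsto (fun n : ℕ => Real.exp (-(1 / ((n : ℝ) + 1)) * t)) atTop (𝓝 1) := by
        have := ((tendsto_one_div_add_atTop_nhds_zero_nat (𝕜 := ℝ)).neg.mul_const t).rexp
        simpa using this
      simpa [G] using (h1.const_mul (u t + (A + B * t))).mul_const (K (T - t))
    · refine ne_top_of_le_ne_top (ENNReal.ofReal_ne_top (r := (∫ y, ‖k y‖ * M) +
        ∫ t in Ici (0 : ℝ), (A + B * t) * K (T - t))) ?_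
      refine liminf_le_of_frequently_le' (.of_forall fun n => ?_)
      rw [← ofReal_integral_norm_eq_lintegral_enorm (hG_int n)]
      refine ENNReal.ofReal_le_ofReal (le_trans (le_of_eq ?_) (hG_le n))
      exact setIntegral_congr_fun measurableSet_Ici fun t ht =>
        abs_of_nonneg (hG_nonneg n t ht)
  refine (key.sub hlin).congr (.of_forall fun t => ?_)
  simp only [Pi.sub_apply]; ring

theorem tendsto_integral_mul_kernel (hu : HasLaplaceExtension u H)
    (hK : IsBandlimitedKernel k K) {A B : ℝ} (hA : 0 ≤ A) (hB : 0 ≤ B)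
    (hbound : ∀ t, 0 ≤ t → -(A + B * t) ≤ u t) :
    Tendsto (fun T => ∫ t in Ici (0 : ℝ), u t * K (T - t)) atTop (𝓝 0) := by
  obtain ⟨M, hM⟩ := hu.exists_norm_le hK
  have key : ∀ T, ((∫ t in Ici (0 : ℝ), u t * K (T - t) : ℝ) : ℂ) =
      𝓕 (fun y : ℝ => k y * H ((0 : ℝ) - 2 * Real.pi * y * I)) T := by
    intro T
    have hx : Tendsto (fun n : ℕ => 1 / ((n : ℝ) + 1)) atTop (𝓝 0) :=
      tendsto_one_div_add_atTop_nhds_zero_nat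
    have hpos : ∀ n : ℕ, 0 < 1 / ((n : ℝ) + 1) := fun n => Nat.one_div_pos_of_nat
    have hle : ∀ n : ℕ, 1 / ((n : ℝ) + 1) ≤ 1 := fun n => by
      rw [div_le_one (by positivity)]; linarith [n.cast_nonneg (α := ℝ)]
    have hleft : Tendsto (fun n : ℕ => ∫ t in Ici (0 : ℝ),
        u t * Real.exp (-(1 / ((n : ℝ) + 1)) * t) * K (T - t)) atTop
        (𝓝 (∫ t in Ici (0 : ℝ), u t * K (T - t))) := by
      refine tendsto_integral_of_dominated_convergence (fun t => ‖u t * K (T - t)‖)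
        (fun n => (hu.integrableOn_mul_exp_mul_kernel hK (hpos n) T).aestronglyMeasurable)
        (hu.integrableOn_mul_kernel hK hA hB hbound T).norm
        (fun n => (ae_restrict_mem measurableSet_Ici).mono fun t (ht : 0 ≤ t) => ?_)
        (.of_forall fun t => ?_)
      · rw [mul_right_comm, norm_mul _ (Real.exp _), Real.norm_eq_abs (Real.exp _), Real.abs_exp]
        refine mul_le_of_le_one_right (norm_nonneg _) ?_
        rw [Real.exp_le_one_iff]; nlinarith [hpos n]
      · have h1 : Tendsto (fun n : ℕ => Real.exp (-(1 / ((n : ℝ) + 1)) * t)) atTop (𝓝 1) := by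
          simpa using (hx.neg.mul_const t).rexp
        simpa using (h1.const_mul (u t)).mul_const (K (T - t))
    have hline : ∀ x : ℝ, 0 ≤ x → Continuous fun y : ℝ => H (x - 2 * Real.pi * y * I) :=
      fun x h0 => hu.continuousOn.comp_continuous (by fun_prop) fun y => by simpa using h0
    have hre : ∀ x : ℝ, 0 ≤ x → ∀ y : ℝ, 0 ≤ ((x : ℂ) - 2 * Real.pi * y * I).re :=
      fun x h0 y => by simpa using h0
    have hright : Tendsto (fun n : ℕ =>
        𝓕 (fun y : ℝ => k y * H ((1 / ((n : ℝ) + 1) : ℝ) - 2 * Real.pi * y * I)) T) atTop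
        (𝓝 (𝓕 (fun y : ℝ => k y * H ((0 : ℝ) - 2 * Real.pi * y * I)) T)) := by
      simp only [Real.fourier_real_eq]
      refine tendsto_integral_of_dominated_convergence (fun y => ‖k y‖ * M)
        (fun n => ?_) (hK.integrable_symbol.norm.mul_const M)
        (fun n => .of_forall fun y => ?_) (.of_forall fun y => ?_)
      · have h1 : Continuous fun y : ℝ => 𝐞 (-(y * T)) := by fun_prop
        exact (h1.smul (hK.continuous_symbol.mul (hline _ (hpos n).le))).aestronglyMeasurable
      · rw [Circle.norm_smul]
        exact hM _ ⟨(hpos n).le, hle n⟩ y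
      · refine Tendsto.const_smul (Tendsto.const_mul _ ?_) _
        refine (hu.continuousOn _ (by simp : (0 : ℝ) ≤ (((0 : ℝ) : ℂ) -
          2 * Real.pi * y * I).re)).tendsto.comp (tendsto_nhdsWithin_iff.2 ⟨?_, ?_⟩)
        · exact ((continuous_ofReal.tendsto 0).comp hx).sub_const _
        · refine .of_forall fun n => ?_
          exact hre _ (hpos n).le y
    refine tendsto_nhds_unique ((continuous_ofReal.tendsto _).comp hleft) (hright.congr fun n => ?_)
    exact (hu.integral_mul_exp_mul_kernel hK (hpos n) T).symm
  have h0 := (Real.zero_at_infty_fourier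
    fun y : ℝ => k y * H ((0 : ℝ) - 2 * Real.pi * y * I)).mono_left atTop_le_cocompact
  have h := (continuous_re.tendsto 0).comp h0
  refine (h.congr fun T => ?_)
  simp only [Function.comp, ← key, ofReal_re]

end HasLaplaceExtension

namespace IsBandlimitedKernel

variable {k : ℝ → ℂ} {K : ℝ → ℝ}

theorem setIntegral_le_one (hK : IsBandlimitedKernel k K) (T : ℝ) :
    ∫ t in Ici (0 : ℝ), K (T - t) ≤ 1 := by
  rw [← hK.integral_eq_one, ← integral_sub_left_eq_self K volume T]
  exact setIntegral_le_integral (hK.integrable.comp_sub_left T) (.of_forall fun t => hK.nonneg _)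

theorem tendsto_setIntegral (hK : IsBandlimitedKernel k K) :
    Tendsto (fun T => ∫ t in Ici (0 : ℝ), K (T - t)) atTop (𝓝 1) := by
  have h := (aecover_Iic (μ := volume) tendsto_id).integral_tendsto_of_countably_generated
    hK.integrable
  rw [hK.integral_eq_one] at h
  refine h.congr fun T => ?_
  rw [← integral_indicator measurableSet_Iic, ← integral_indicator measurableSet_Ici,
    ← integral_sub_left_eq_self _ volume T]
  refine integral_congr_ae (.of_forall fun t => ?_)
  simp [indicator]

theorem mul_setIntegral_le (hK : IsBandlimitedKernel k K) {s : ℝ → ℝ} {T σ E : ℝ} (hE : 0 ≤ E)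
    (hs : IntegrableOn (fun t => s t * K (T - t)) (Ici 0))
    (hσ : ∀ t, 0 ≤ t → σ - E * |T - t| ≤ s t) :
    σ * ∫ t in Ici (0 : ℝ), K (T - t) ≤
      (∫ t in Ici (0 : ℝ), s t * K (T - t)) + E * ∫ v, |v| * K v := by
  have h1 : IntegrableOn (fun t => K (T - t)) (Ici 0) :=
    (hK.integrable.comp_sub_left T).integrableOn
  have h2 : Integrable fun t => |T - t| * K (T - t) := hK.integrable_abs_mul.comp_sub_left T
  have h3 : ∫ t in Ici (0 : ℝ), |T - t| * K (T - t) ≤ ∫ v, |v| * K v := by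
    rw [← integral_sub_left_eq_self (fun v => |v| * K v) volume T]
    exact setIntegral_le_integral h2
      (.of_forall fun t => mul_nonneg (abs_nonneg _) (hK.nonneg _))
  have h4 : ∫ t in Ici (0 : ℝ), (σ * K (T - t) - E * (|T - t| * K (T - t))) ≤
      ∫ t in Ici (0 : ℝ), s t * K (T - t) := by
    refine setIntegral_mono_on ((h1.const_mul σ).sub (h2.integrableOn.const_mul E)) hs
      measurableSet_Ici fun t ht => ?_
    linarith [mul_le_mul_of_nonneg_right (hσ t ht) (hK.nonneg (T - t))]
  rw [integral_sub (h1.const_mul σ) (h2.integrableOn.const_mul E), integral_const_mul,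
    integral_const_mul] at h4
  linarith [mul_le_mul_of_nonneg_left h3 hE]

end IsBandlimitedKernel

theorem sub_mul_abs_le {s : ℝ → ℝ} {D δ : ℝ} (hD : 0 ≤ D) (hδ : 0 < δ) (hδ1 : δ ≤ 1)
    (hgrow : ∀ t T, 0 ≤ t → 0 ≤ T → |s T - s t| ≤ D * (1 + |T - t|)) {T T' t : ℝ} (hT : 0 ≤ T)
    (ht : 0 ≤ t) (hTT' : |T - T'| = δ)
    (hnear : |T' - t| ≤ δ → s T - s t ≤ 2 * D * δ) :
    s T - 2 * D * δ - 3 * D / δ * |T' - t| ≤ s t := by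
  rcases le_or_gt |T' - t| δ with h | h
  · have : 0 ≤ 3 * D / δ * |T' - t| := by positivity
    linarith [hnear h]
  · have h1 := (le_abs_self _).trans (hgrow t T ht hT)
    have h2 : |T - t| ≤ δ + |T' - t| := by
      rw [← hTT']
      exact abs_sub_le T T' t
    have h3 : 1 + |T - t| ≤ 3 / δ * |T' - t| := by
      rw [div_mul_eq_mul_div, le_div_iff₀ hδ]
      nlinarith [abs_nonneg (T - t), abs_nonneg (T' - t)]
    have h4 : 3 * D / δ * |T' - t| = D * (3 / δ * |T' - t|) := by ring
    have h5 : 0 ≤ 2 * D * δ := by positivity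
    linarith [mul_le_mul_of_nonneg_left h3 hD]

theorem eventually_le_of_tendsto_kernel {k : ℝ → ℂ} {K : ℝ → ℝ} (hK : IsBandlimitedKernel k K)
    {s : ℝ → ℝ} {D : ℝ} (hD : 0 ≤ D)
    (hgrow : ∀ t T, 0 ≤ t → 0 ≤ T → |s T - s t| ≤ D * (1 + |T - t|))
    (hint : ∀ {k K}, IsBandlimitedKernel k K → ∀ T, IntegrableOn (fun t => s t * K (T - t)) (Ici 0))
    (hlim : ∀ {k K}, IsBandlimitedKernel k K →
      Tendsto (fun T => ∫ t in Ici (0 : ℝ), s t * K (T - t)) atTop (𝓝 0))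
    (θ : ℝ) (hθ : |θ| = 1)
    (hnear : ∀ δ T t, 0 ≤ t → 0 ≤ T → |T + θ * δ - t| ≤ δ → s T - s t ≤ 2 * D * δ)
    {ε : ℝ} (hε : 0 < ε) : ∀ᶠ T in atTop, s T ≤ ε := by
  set m := ∫ v, |v| * K v with hm
  have hm0 : 0 ≤ m := integral_nonneg fun v => mul_nonneg (abs_nonneg _) (hK.nonneg _)
  set N := 2 * D + 2 + 6 * D * m with hN
  have hNpos : 0 < N := by positivity
  set δ := min 1 (ε / N)
  have hδ : 0 < δ := lt_min one_pos (by positivity)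
  have hδ1 : δ ≤ 1 := min_le_left _ _
  have hδε : N * δ ≤ ε := by
    have : δ ≤ ε / N := min_le_right _ _
    rwa [le_div_iff₀ hNpos, mul_comm] at this
  have hr : 0 < (δ ^ 2)⁻¹ := by positivity
  have hK' := hK.dilate hr
  have hshift : Tendsto (fun T => T + θ * δ) atTop atTop :=
    tendsto_atTop_add_const_right _ _ tendsto_id
  have hI := ((hlim hK').comp hshift).eventually (eventually_le_nhds hδ)
  have hmass := (hK'.tendsto_setIntegral.comp hshift).eventually
    (eventually_ge_nhds (by norm_num : (1 / 2 : ℝ) < 1))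
  filter_upwards [hI, hmass, eventually_ge_atTop 0] with T hIT hmT hT
  have hTT' : |T - (T + θ * δ)| = δ := by
    rw [sub_add_cancel_left, abs_neg, abs_mul, hθ, one_mul, abs_of_pos hδ]
  have h := hK'.mul_setIntegral_le (σ := s T - 2 * D * δ) (E := 3 * D / δ) (by positivity)
    (hint hK' (T + θ * δ)) fun t ht =>
      sub_mul_abs_le hD hδ hδ1 hgrow hT ht hTT' (hnear δ T t ht hT)
  rw [IsBandlimitedKernel.integral_abs_mul_dilate K hr, ← hm, inv_inv] at h
  have h1 : 3 * D / δ * (δ ^ 2 * m) = 3 * D * m * δ := by field_simp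
  rw [h1] at h
  simp only [Function.comp] at hIT hmT
  by_contra! hcon
  have h2 : 0 ≤ s T - 2 * D * δ := by nlinarith [mul_nonneg (mul_nonneg hD hm0) hδ.le]
  nlinarith [mul_le_mul_of_nonneg_left hmT h2]

theorem tendsto_zero_of_tendsto_kernel {s : ℝ → ℝ} {D : ℝ} (hD : 0 ≤ D)
    (hgrow : ∀ t T, 0 ≤ t → 0 ≤ T → |s T - s t| ≤ D * (1 + |T - t|))
    (hslow : ∀ t T, 0 ≤ t → t ≤ T → s t - s T ≤ D * (T - t))
    (hint : ∀ {k K}, IsBandlimitedKernel k K → ∀ T, IntegrableOn (fun t => s t * K (T - t)) (Ici 0))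
    (hlim : ∀ {k K}, IsBandlimitedKernel k K →
      Tendsto (fun T => ∫ t in Ici (0 : ℝ), s t * K (T - t)) atTop (𝓝 0)) :
    Tendsto s atTop (𝓝 0) := by
  obtain ⟨k, K, hK⟩ := IsBandlimitedKernel.exists_kernel
  have hup : ∀ ε > 0, ∀ᶠ T in atTop, s T ≤ ε := fun ε hε =>
    eventually_le_of_tendsto_kernel hK hD hgrow hint hlim 1 (by simp)
      (fun δ T t ht hT h => by
        rw [one_mul, abs_le] at h
        refine (hslow T t hT (by linarith)).trans ?_
        nlinarith) hε
  have hlow : ∀ ε > 0, ∀ᶠ T in atTop, -s T ≤ ε := fun ε hε =>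
    eventually_le_of_tendsto_kernel hK (s := fun t => -s t) hD
      (fun t T ht hT => by
        rw [neg_sub_neg, abs_sub_comm]
        exact hgrow t T ht hT)
      (fun hK T => by simpa using (hint hK T).neg)
      (fun hK => by simpa [integral_neg] using (hlim hK).neg) (-1) (by simp)
      (fun δ T t ht hT h => by
        rw [abs_le] at h
        have := hslow t T ht (by linarith)
        nlinarith) hε
  rw [Metric.tendsto_nhds]
  intro ε hε
  filter_upwards [hup (ε / 2) (by positivity), hlow (ε / 2) (by positivity)] with T h1 h2
  rw [Real.dist_eq, sub_zero, abs_lt]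
  constructor <;> linarith

theorem integrableOn_Ici_exp_neg_mul {z : ℂ} (hz : 0 < z.re) :
    IntegrableOn (fun T : ℝ => exp (-z * T)) (Ici 0) := by
  rw [integrableOn_Ici_iff_integrableOn_Ioi]
  exact integrableOn_exp_mul_complex_Ioi (by simpa using hz) 0

theorem integral_Ici_exp_neg_mul {z : ℂ} (hz : 0 < z.re) :
    ∫ T : ℝ in Ici 0, exp (-z * T) = z⁻¹ := by
  rw [integral_Ici_eq_integral_Ioi, integral_exp_mul_complex_Ioi (by simpa using hz) 0]
  simp

namespace HasLaplaceExtension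

variable {u : ℝ → ℝ} {H : ℂ → ℂ}

theorem intervalIntegrable (hu : HasLaplaceExtension u H) {a b : ℝ} (ha : 0 ≤ a) (hb : 0 ≤ b) :
    IntervalIntegrable u volume a b := by
  have hsub : uIcc a b ⊆ Ici 0 := fun t ht => (le_min ha hb).trans ht.1
  have h : IntervalIntegrable (fun t => u t * Real.exp (-1 * t)) volume a b :=
    ((hu.integrableOn_mul_exp one_pos).mono_set hsub).intervalIntegrable
  refine (h.mul_continuousOn (g := fun t => Real.exp t) (by fun_prop)).congr
    fun t _ => ?_
  rw [mul_assoc, ← Real.exp_add]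
  simp

theorem im_apply_ofReal (hu : HasLaplaceExtension u H) {x : ℝ} (hx : 0 < x) : (H x).im = 0 := by
  have h : H x = ((∫ T in Ici (0 : ℝ), u T * Real.exp (-x * T) : ℝ) : ℂ) := by
    rw [hu.eq_integral x (by simpa using hx), ← integral_complex_ofReal]
    simp
  rw [h, ofReal_im]

theorem tendsto_nhdsGT_zero (hu : HasLaplaceExtension u H) :
    Tendsto (fun x : ℝ => H x) (𝓝[>] 0) (𝓝 (H 0)) := by
  refine (hu.continuousOn 0 (by simp)).tendsto.comp (tendsto_nhdsWithin_iff.2 ⟨?_, ?_⟩)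
  · exact (by simpa using continuous_ofReal.tendsto (0 : ℝ) :
      Tendsto ofReal (𝓝 0) (𝓝 0)).mono_left nhdsWithin_le_nhds
  · filter_upwards [self_mem_nhdsWithin] with x hx
    simpa using (mem_Ioi.1 hx).le

theorem im_apply_zero (hu : HasLaplaceExtension u H) : (H 0).im = 0 := by
  refine tendsto_nhds_unique ((continuous_im.tendsto _).comp hu.tendsto_nhdsGT_zero)
    (tendsto_const_nhds.congr' ?_)
  filter_upwards [self_mem_nhdsWithin] with x hx using (hu.im_apply_ofReal hx).symm

theorem primitive_sub (hu : HasLaplaceExtension u H) {U : Set ℂ} (hU : IsOpen U)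
    (hUsub : {z : ℂ | 0 ≤ z.re} ⊆ U) (hH : DifferentiableOn ℂ H U) :
    HasLaplaceExtension (fun T => (∫ t in 0..T, u t) - (H 0).re) (dslope H 0) := by
  have hH0 : ((H 0).re : ℂ) = H 0 := Complex.ext rfl (by simp [hu.im_apply_zero])
  have hconv : ∀ (z : ℂ) (T : ℝ),
      ((∫ t in 0..T, u t : ℝ) : ℂ) * exp (-z * T) =
      ∫ t in 0..T, ContinuousLinearMap.mul ℝ ℂ ((u t : ℂ) * exp (-z * t))
        (exp (-z * ((T - t : ℝ) : ℂ))) := by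
    intro z T
    rw [← intervalIntegral.integral_ofReal, ← intervalIntegral.integral_mul_const]
    refine intervalIntegral.integral_congr fun t _ => ?_
    simp only [ContinuousLinearMap.mul_apply', mul_assoc]
    rw [← exp_add]
    push_cast
    ring_nf
  have hint : ∀ z : ℂ, 0 < z.re →
      IntegrableOn (fun T : ℝ => ((∫ t in 0..T, u t : ℝ) : ℂ) * exp (-z * T)) (Ici 0) := by
    intro z hz
    have h := integrable_posConvolution
      ((hu.integrableOn z hz).mono_set Ioi_subset_Ici_self)
      ((integrableOn_Ici_exp_neg_mul hz).mono_set Ioi_subset_Ici_self)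
      (ContinuousLinearMap.mul ℝ ℂ)
    rw [integrableOn_Ici_iff_integrableOn_Ioi]
    unfold posConvolution at h
    rw [integrable_indicator_iff measurableSet_Ioi] at h
    simpa only [hconv] using h
  have hsub : ∀ (z : ℂ) (T : ℝ), (((∫ t in 0..T, u t) - (H 0).re : ℝ) : ℂ) * exp (-z * T) =
      ((∫ t in 0..T, u t : ℝ) : ℂ) * exp (-z * T) - H 0 * exp (-z * T) := by
    intro z T
    rw [ofReal_sub, hH0, sub_mul]
  refine ⟨fun z hz => ?_, ?_, fun z hz => ?_⟩
  · simp only [hsub]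
    exact (hint z hz).sub ((integrableOn_Ici_exp_neg_mul hz).const_mul _)
  · exact ((differentiableOn_dslope (hU.mem_nhds (hUsub (by simp)))).2 hH).continuousOn.mono hUsub
  · have hz0 : z ≠ 0 := by rintro rfl; simp at hz
    simp only [hsub]
    rw [integral_sub (hint z hz) ((integrableOn_Ici_exp_neg_mul hz).const_mul _),
      integral_const_mul, integral_Ici_exp_neg_mul hz]
    simp only [hconv]
    rw [integral_Ici_eq_integral_Ioi, integral_posConvolution
      ((hu.integrableOn z hz).mono_set Ioi_subset_Ici_self)
      ((integrableOn_Ici_exp_neg_mul hz).mono_set Ioi_subset_Ici_self),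
      ← integral_Ici_eq_integral_Ioi, ← integral_Ici_eq_integral_Ioi, ← hu.eq_integral z hz,
      integral_Ici_exp_neg_mul hz, dslope_of_ne _ hz0, slope_def_field,
      ContinuousLinearMap.mul_apply', sub_zero]
    field_simp

end HasLaplaceExtension

theorem exists_forall_integral_le {β : ℝ → ℝ} {c : ℝ} {G : ℂ → ℂ} (hβ : ∀ t, 0 ≤ t → 0 ≤ β t)
    (hu : HasLaplaceExtension (fun t => β t - c) G) :
    ∃ B, 0 ≤ B ∧ ∀ a h, 0 ≤ a → 0 ≤ h → ∫ t in a..(a + h), β t ≤ B * (1 + h) := by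
  have hii : ∀ {a b : ℝ}, 0 ≤ a → 0 ≤ b → IntervalIntegrable β volume a b := fun ha hb => by
    simpa using (hu.intervalIntegrable ha hb).add (intervalIntegrable_const (c := c))
  have hnn : ∀ {a b : ℝ}, 0 ≤ a → a ≤ b → 0 ≤ ∫ t in a..b, β t := fun ha hab =>
    intervalIntegral.integral_nonneg hab fun t ht => hβ t (ha.trans ht.1)
  obtain ⟨k, K, hK⟩ := IsBandlimitedKernel.exists_kernel
  obtain ⟨v, hv⟩ : ∃ v, 0 < K v := by
    by_contra! h
    have h0 : K = fun _ => 0 := funext fun v => le_antisymm (h v) (hK.nonneg v)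
    simpa [h0] using hK.integral_eq_one
  obtain ⟨η, hη, hKη⟩ : ∃ η > 0, ∀ w, |w - v| ≤ η → K v / 2 ≤ K w := by
    have := hK.continuous.continuousAt.eventually (eventually_ge_nhds (half_lt_self hv))
    obtain ⟨η, hη, h⟩ := Metric.eventually_nhds_iff.1 this
    refine ⟨η / 2, by positivity, fun w hw => h ?_⟩
    rw [Real.dist_eq]
    linarith
  have hlower : ∀ t, 0 ≤ t → -(|c| + 0 * t) ≤ β t - c := fun t ht => by
    linarith [hβ t ht, le_abs_self c]
  have hKi : ∀ T, IntegrableOn (fun t => K (T - t)) (Ici 0) := fun T =>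
    (hK.integrable.comp_sub_left T).integrableOn
  have hαi := hu.integrableOn_mul_kernel hK (abs_nonneg c) le_rfl hlower
  have hβi : ∀ T, IntegrableOn (fun t => β t * K (T - t)) (Ici 0) := fun T => by
    refine ((hαi T).add ((hKi T).const_mul c)).congr (.of_forall fun t => ?_)
    simp only [Pi.add_apply]; ring
  have hev : ∀ᶠ T in atTop, ∫ t in Ici (0 : ℝ), β t * K (T - t) ≤ 1 + |c| := by
    filter_upwards [(hu.tendsto_integral_mul_kernel hK (abs_nonneg c) le_rfl hlower).eventually
      (eventually_le_nhds one_pos)] with T hT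
    have h1 : ∫ t in Ici (0 : ℝ), (β t - c) * K (T - t) =
        (∫ t in Ici (0 : ℝ), β t * K (T - t)) - c * ∫ t in Ici (0 : ℝ), K (T - t) := by
      rw [← integral_const_mul, ← integral_sub (hβi T) ((hKi T).const_mul c)]
      simp only [sub_mul]
    have h2 : 0 ≤ ∫ t in Ici (0 : ℝ), K (T - t) := integral_nonneg fun t => hK.nonneg _
    nlinarith [hK.setIntegral_le_one T, le_abs_self c, abs_nonneg c]
  obtain ⟨T₀, hT₀⟩ := eventually_atTop.1 hev
  have hfar : ∀ a, 0 ≤ a → T₀ - v ≤ a → ∫ t in a..(a + η), β t ≤ (1 + |c|) / (K v / 2) := by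
    intro a ha haT
    rw [le_div_iff₀ (by positivity), ← intervalIntegral.integral_mul_const]
    refine le_trans ?_ (hT₀ (a + v) (by linarith))
    rw [intervalIntegral.integral_of_le (by linarith)]
    have hsub : Ioc a (a + η) ⊆ Ici 0 := fun t ht => ha.trans ht.1.le
    refine (setIntegral_mono_on ((hii ha (by linarith)).1.mul_const _)
      ((hβi (a + v)).mono_set hsub) measurableSet_Ioc fun t ht => ?_).trans
      (setIntegral_mono_set (hβi (a + v))
        ((ae_restrict_mem measurableSet_Ici).mono fun t ht => mul_nonneg (hβ t ht) (hK.nonneg _))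
        hsub.eventuallyLE)
    refine mul_le_mul_of_nonneg_left (hKη _ ?_) (hβ t (hsub ht))
    rw [abs_le]
    constructor <;> linarith [ht.1, ht.2]
  set a₀ := max 0 (T₀ - v)
  have ha₀ : 0 ≤ a₀ := le_max_left _ _
  set B₁ := (1 + |c|) / (K v / 2) + ∫ t in 0..(a₀ + η), β t with hB₁_def
  have hB₁ : 0 ≤ B₁ := add_nonneg (by positivity) (hnn le_rfl (by positivity))
  have hstep : ∀ a, 0 ≤ a → ∫ t in a..(a + η), β t ≤ B₁ := by
    intro a ha
    rcases le_total a₀ a with h | h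
    · linarith [hfar a ha ((le_max_right _ _).trans h),
        hnn le_rfl (by positivity : 0 ≤ a₀ + η)]
    · have h1 := intervalIntegral.integral_add_adjacent_intervals (hii le_rfl ha)
        (hii ha (by positivity : 0 ≤ a + η))
      have h2 := intervalIntegral.integral_add_adjacent_intervals
        (hii le_rfl (by positivity : 0 ≤ a + η)) (hii (by positivity) (by positivity : 0 ≤ a₀ + η))
      have h3 : 0 ≤ (1 + |c|) / (K v / 2) := by positivity
      linarith [hnn le_rfl ha, hnn (by positivity : 0 ≤ a + η) (by linarith : a + η ≤ a₀ + η)]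
  have hsteps : ∀ (n : ℕ) a, 0 ≤ a → ∫ t in a..(a + n * η), β t ≤ n * B₁ := by
    intro n a ha
    induction n with
    | zero => simp
    | succ n ih =>
      have h1 : a + ((n + 1 : ℕ) : ℝ) * η = a + n * η + η := by push_cast; ring
      rw [h1, ← intervalIntegral.integral_add_adjacent_intervals
        (hii ha (by positivity : 0 ≤ a + n * η)) (hii (by positivity) (by positivity))]
      push_cast
      linarith [hstep (a + n * η) (by positivity)]
  refine ⟨B₁ * (1 + η⁻¹), by positivity, fun a h ha hh => ?_⟩
  have hn1 : h ≤ ⌈h / η⌉₊ * η := (div_le_iff₀ hη).1 (Nat.le_ceil _)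
  have hn2 : (⌈h / η⌉₊ : ℝ) ≤ h / η + 1 := (Nat.ceil_lt_add_one (by positivity)).le
  have h1 := intervalIntegral.integral_add_adjacent_intervals (hii ha (by positivity : 0 ≤ a + h))
    (hii (by positivity) (by positivity : 0 ≤ a + ⌈h / η⌉₊ * η))
  have h2 := hnn (by positivity : 0 ≤ a + h) (by linarith : a + h ≤ a + ⌈h / η⌉₊ * η)
  have h3 : h / η + 1 ≤ (1 + η⁻¹) * (1 + h) := by
    rw [div_eq_mul_inv]
    nlinarith [inv_pos.2 hη]
  nlinarith [hsteps ⌈h / η⌉₊ a ha, mul_le_mul_of_nonneg_left (hn2.trans h3) hB₁]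

theorem tendsto_integral_sub_const {β : ℝ → ℝ} {c : ℝ} {G : ℂ → ℂ}
    (hβ : ∀ t, 0 ≤ t → 0 ≤ β t) (hu : HasLaplaceExtension (fun t => β t - c) G) {U : Set ℂ}
    (hU : IsOpen U) (hUsub : {z : ℂ | 0 ≤ z.re} ⊆ U) (hG : DifferentiableOn ℂ G U) :
    Tendsto (fun T => ∫ t in 0..T, (β t - c)) atTop (𝓝 (G 0).re) := by
  obtain ⟨B, hB, hgrowth⟩ := exists_forall_integral_le hβ hu
  have hs := hu.primitive_sub hU hUsub hG
  set s : ℝ → ℝ := fun T => (∫ t in 0..T, (β t - c)) - (G 0).re with hs_def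
  have hii : ∀ {a b : ℝ}, 0 ≤ a → 0 ≤ b → IntervalIntegrable β volume a b := fun ha hb => by
    simpa using (hu.intervalIntegrable ha hb).add (intervalIntegrable_const (c := c))
  have hdiff : ∀ t T, 0 ≤ t → t ≤ T → s T - s t = (∫ r in t..T, β r) - c * (T - t) := by
    intro t T ht htT
    have h := intervalIntegral.integral_add_adjacent_intervals
      (hu.intervalIntegrable le_rfl ht) (hu.intervalIntegrable ht (ht.trans htT))
    have h2 := intervalIntegral.integral_sub (hii ht (ht.trans htT))
      (intervalIntegrable_const (c := c))
    rw [intervalIntegral.integral_const, smul_eq_mul] at h2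
    simp only [hs_def]
    linarith
  have hnn : ∀ t T, 0 ≤ t → t ≤ T → 0 ≤ ∫ r in t..T, β r := fun t T ht htT =>
    intervalIntegral.integral_nonneg htT fun r hr => hβ r (ht.trans hr.1)
  have hD : 0 ≤ B + |c| := by positivity
  have hslow : ∀ t T, 0 ≤ t → t ≤ T → s t - s T ≤ (B + |c|) * (T - t) := by
    intro t T ht htT
    nlinarith [hdiff t T ht htT, hnn t T ht htT, le_abs_self c, sub_nonneg.2 htT]
  have hgrow' : ∀ t T, 0 ≤ t → t ≤ T → |s T - s t| ≤ (B + |c|) * (1 + |T - t|) := by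
    intro t T ht htT
    have h1 := hgrowth t (T - t) ht (sub_nonneg.2 htT)
    rw [add_sub_cancel] at h1
    rw [abs_of_nonneg (sub_nonneg.2 htT), abs_le]
    constructor
    · nlinarith [hslow t T ht htT]
    · nlinarith [hdiff t T ht htT, neg_abs_le c, abs_nonneg c, sub_nonneg.2 htT]
  have hgrow : ∀ t T, 0 ≤ t → 0 ≤ T → |s T - s t| ≤ (B + |c|) * (1 + |T - t|) := by
    intro t T ht hT
    rcases le_total t T with h | h
    · exact hgrow' t T ht h
    · rw [abs_sub_comm, abs_sub_comm T]
      exact hgrow' T t hT h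
  have hlower : ∀ t, 0 ≤ t → -((|s 0| + (B + |c|)) + (B + |c|) * t) ≤ s t := by
    intro t ht
    have h := hgrow 0 t le_rfl ht
    rw [sub_zero, abs_of_nonneg ht, abs_le] at h
    linarith [neg_abs_le (s 0)]
  have h0 := tendsto_zero_of_tendsto_kernel hD hgrow hslow
    (fun hK => hs.integrableOn_mul_kernel hK (by positivity) hD hlower)
    (fun hK => hs.tendsto_integral_mul_kernel hK (by positivity) hD hlower)
  simpa [hs_def] using h0.add_const (G 0).re
theorem tendsto_ofReal_nhdsGT_nhdsNE :
    Tendsto (fun x : ℝ => (x : ℂ)) (𝓝[>] 0) (𝓝[≠] 0) := by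
  refine tendsto_nhdsWithin_iff.2 ⟨?_, ?_⟩
  · exact (by simpa using continuous_ofReal.tendsto (0 : ℝ) :
      Tendsto ofReal (𝓝 0) (𝓝 0)).mono_left nhdsWithin_le_nhds
  · filter_upwards [self_mem_nhdsWithin] with x hx
    simpa using (mem_Ioi.1 hx).ne'

/-- Subtracting the residue removes a simple pole at the origin from a Laplace transform. -/
theorem exists_hasLaplaceExtension_sub {β : ℝ → ℝ} {F : ℂ → ℂ} {U : Set ℂ} (hU : IsOpen U)
    (hUsub : {z : ℂ | 0 ≤ z.re} ⊆ U)
    (hint : ∀ z : ℂ, 0 < z.re →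
      IntegrableOn (fun T : ℝ => (β T : ℂ) * exp (-z * T)) (Ici (0 : ℝ)))
    (hF : DifferentiableOn ℂ F (U \ {0}))
    (hF_eq : ∀ z : ℂ, 0 < z.re → F z = ∫ T in Ici (0 : ℝ), (β T : ℂ) * exp (-z * T))
    (hpole : ∃ r : ℂ, Tendsto (fun z : ℂ => z * F z) (𝓝[≠] 0) (𝓝 r)) :
    ∃ (c : ℝ) (G : ℂ → ℂ), Tendsto (fun z : ℂ => z * F z) (𝓝[≠] 0) (𝓝 c) ∧
      DifferentiableOn ℂ G U ∧ HasLaplaceExtension (fun t => β t - c) G ∧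
      ∀ z : ℂ, 0 < z.re → F z = c / z + G z := by
  obtain ⟨r, hr⟩ := hpole
  have hr0 : r.im = 0 := by
    refine tendsto_nhds_unique
      ((continuous_im.tendsto _).comp (hr.comp tendsto_ofReal_nhdsGT_nhdsNE))
      (tendsto_const_nhds.congr' ?_)
    filter_upwards [self_mem_nhdsWithin] with x hx
    have h : F x = ((∫ T in Ici (0 : ℝ), β T * Real.exp (-x * T) : ℝ) : ℂ) := by
      rw [hF_eq x (by simpa using hx), ← integral_complex_ofReal]
      simp
    simp only [Function.comp, h, ← ofReal_mul, ofReal_im]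
  obtain ⟨c, rfl⟩ : ∃ c : ℝ, r = c := ⟨r.re, Complex.ext rfl (by simp [hr0])⟩
  have hU0 : U ∈ 𝓝 0 := hU.mem_nhds (hUsub (by simp))
  set N : ℂ → ℂ := Function.update (fun z => z * F z) 0 c with hN
  have hNd : DifferentiableOn ℂ N U := by
    refine (differentiableOn_compl_singleton_and_continuousAt_iff hU0).1
      ⟨?_, continuousAt_update_same.2 hr⟩
    exact (differentiableOn_id.mul hF).congr fun z hz => Function.update_of_ne hz.2 _ _
  have hGd : DifferentiableOn ℂ (dslope N 0) U := (differentiableOn_dslope hU0).2 hNd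
  have hG : ∀ z : ℂ, 0 < z.re → F z = c / z + dslope N 0 z := by
    intro z hz
    have hz0 : z ≠ 0 := by rintro rfl; simp at hz
    rw [dslope_of_ne _ hz0, slope_def_field, hN, Function.update_self, Function.update_of_ne hz0,
      sub_zero]
    field_simp
    ring
  have hsub : ∀ (z : ℂ) (T : ℝ), ((β T - c : ℝ) : ℂ) * exp (-z * T) =
      (β T : ℂ) * exp (-z * T) - c * exp (-z * T) := by
    intro z T; push_cast; ring
  refine ⟨c, dslope N 0, hr, hGd, ⟨fun z hz => ?_, hGd.continuousOn.mono hUsub, fun z hz => ?_⟩, hG⟩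
  · simp only [hsub]
    exact (hint z hz).sub ((integrableOn_Ici_exp_neg_mul hz).const_mul _)
  · simp only [hsub]
    rw [integral_sub (hint z hz) ((integrableOn_Ici_exp_neg_mul hz).const_mul _),
      integral_const_mul, integral_Ici_exp_neg_mul hz, ← hF_eq z hz, hG z hz]
    ring

theorem mul_integral_mul_exp_of_hasDerivAt {f f' : ℝ → ℝ}
    (hderiv : ∀ T : ℝ, 0 ≤ T → HasDerivAt f (f' T) T) {z : ℂ}
    (hf : IntegrableOn (fun T : ℝ => (f T : ℂ) * exp (-z * T)) (Ici (0 : ℝ)))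
    (hf' : IntegrableOn (fun T : ℝ => (f' T : ℂ) * exp (-z * T)) (Ici (0 : ℝ))) :
    z * ∫ T in Ici (0 : ℝ), (f T : ℂ) * exp (-z * T) =
      f 0 + ∫ T in Ici (0 : ℝ), (f' T : ℂ) * exp (-z * T) := by
  have hd : ∀ T : ℝ, 0 ≤ T → HasDerivAt (fun T : ℝ => (f T : ℂ) * exp (-z * T))
      ((f' T : ℂ) * exp (-z * T) - z * ((f T : ℂ) * exp (-z * T))) T := by
    intro T hT
    have h1 : HasDerivAt (fun T : ℝ => exp (-z * T)) (exp (-z * T) * (-z * 1)) T :=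
      ((ofRealCLM.hasDerivAt (x := T)).const_mul (-z)).cexp
    convert! (hderiv T hT).ofReal_comp.mul h1 using 1
    ring
  have hi := hf'.sub (hf.const_mul z)
  have hlim : Tendsto (fun T : ℝ => (f T : ℂ) * exp (-z * T)) atTop (𝓝 0) :=
    tendsto_zero_of_hasDerivAt_of_integrableOn_Ioi (a := 0) (fun T hT => hd T (mem_Ioi.1 hT).le)
      (hi.mono_set Ioi_subset_Ici_self) (hf.mono_set Ioi_subset_Ici_self)
  have h := integral_Ioi_of_hasDerivAt_of_tendsto' (fun T hT => hd T hT)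
    (hi.mono_set Ioi_subset_Ici_self) hlim
  rw [← integral_Ici_eq_integral_Ioi, integral_sub hf' (hf.const_mul z), integral_const_mul] at h
  simp only [ofReal_zero, mul_zero, exp_zero, mul_one] at h
  linear_combination -h

end

/-- Tauberian theorem, `k = 0` case: if `f ≥ 0` has derivative `α₊ − α₋` with `α± ≥ 0`,
the Laplace transforms of `f, α₊, α₋` converge for `Re z > 0` and extend to an open set
containing the closed half-plane, holomorphically away from a unique (at most simple)
pole at `0`, and `z·Lf(z) → C > 0`, then `f(T) → C`. -/
theorem tauberian_k0
    (f alphaP alphaM : ℝ → ℝ)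
    (hf_nonneg : ∀ T : ℝ, 0 ≤ T → 0 ≤ f T)
    (hP_nonneg : ∀ T : ℝ, 0 ≤ T → 0 ≤ alphaP T)
    (hM_nonneg : ∀ T : ℝ, 0 ≤ T → 0 ≤ alphaM T)
    (hderiv : ∀ T : ℝ, 0 ≤ T → HasDerivAt f (alphaP T - alphaM T) T)
    (hf_laplace : ∀ z : ℂ, 0 < z.re →
      IntegrableOn (fun T : ℝ => (f T : ℂ) * Complex.exp (-z * T)) (Set.Ici (0 : ℝ)))
    (hP_laplace : ∀ z : ℂ, 0 < z.re →
      IntegrableOn (fun T : ℝ => (alphaP T : ℂ) * Complex.exp (-z * T)) (Set.Ici (0 : ℝ)))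
    (hM_laplace : ∀ z : ℂ, 0 < z.re →
      IntegrableOn (fun T : ℝ => (alphaM T : ℂ) * Complex.exp (-z * T)) (Set.Ici (0 : ℝ)))
    (U : Set ℂ) (hU_open : IsOpen U) (hU_halfplane : {z : ℂ | 0 ≤ z.re} ⊆ U)
    (Ff Fp Fm : ℂ → ℂ)
    (hFf_holo : DifferentiableOn ℂ Ff (U \ {0}))
    (hFp_holo : DifferentiableOn ℂ Fp (U \ {0}))
    (hFm_holo : DifferentiableOn ℂ Fm (U \ {0}))
    (hFf_eq : ∀ z : ℂ, 0 < z.re →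
      Ff z = ∫ T in Set.Ici (0 : ℝ), (f T : ℂ) * Complex.exp (-z * T))
    (hFp_eq : ∀ z : ℂ, 0 < z.re →
      Fp z = ∫ T in Set.Ici (0 : ℝ), (alphaP T : ℂ) * Complex.exp (-z * T))
    (hFm_eq : ∀ z : ℂ, 0 < z.re →
      Fm z = ∫ T in Set.Ici (0 : ℝ), (alphaM T : ℂ) * Complex.exp (-z * T))
    (C : ℝ) (hC : 0 < C)
    (hFf_pole : Tendsto (fun z : ℂ => z * Ff z) (nhdsWithin 0 {0}ᶜ) (nhds (C : ℂ)))
    (hFp_pole : ∃ cp : ℂ,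
      Tendsto (fun z : ℂ => z * Fp z) (nhdsWithin 0 {0}ᶜ) (nhds cp))
    (hFm_pole : ∃ cm : ℂ,
      Tendsto (fun z : ℂ => z * Fm z) (nhdsWithin 0 {0}ᶜ) (nhds cm)) :
    Tendsto f atTop (nhds C) := by
  obtain ⟨cp, Gp, hcp, hGp, hup, hFp⟩ := exists_hasLaplaceExtension_sub hU_open hU_halfplane
    hP_laplace hFp_holo hFp_eq hFp_pole
  obtain ⟨cm, Gm, hcm, hGm, hum, hFm⟩ := exists_hasLaplaceExtension_sub hU_open hU_halfplane
    hM_laplace hFm_holo hFm_eq hFm_pole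
  have hint : ∀ z : ℂ, 0 < z.re → IntegrableOn
      (fun T : ℝ => ((alphaP T - alphaM T : ℝ) : ℂ) * Complex.exp (-z * T)) (Set.Ici 0) := by
    intro z hz
    simpa only [Complex.ofReal_sub, sub_mul] using! (hP_laplace z hz).sub (hM_laplace z hz)
  have hrel : ∀ z : ℂ, 0 < z.re → z * Ff z = f 0 + Fp z - Fm z := by
    intro z hz
    rw [hFf_eq z hz, mul_integral_mul_exp_of_hasDerivAt hderiv (hf_laplace z hz) (hint z hz),
      hFp_eq z hz, hFm_eq z hz, add_sub_assoc,
      ← integral_sub (hP_laplace z hz) (hM_laplace z hz)]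
    simp only [Complex.ofReal_sub, sub_mul]
  have hlim := tendsto_ofReal_nhdsGT_nhdsNE
  have hx0 : Tendsto (fun x : ℝ => (x : ℂ)) (nhdsWithin 0 (Set.Ioi 0)) (nhds 0) :=
    hlim.mono_right nhdsWithin_le_nhds
  have hc : (cp : ℂ) = cm := by
    have h1 := hx0.mul (hFf_pole.comp hlim)
    have h2 := ((hx0.mul_const (f 0 : ℂ)).add (hcp.comp hlim)).sub (hcm.comp hlim)
    have h3 := tendsto_nhds_unique h1 (h2.congr' (by
      filter_upwards [self_mem_nhdsWithin] with x hx
      simp only [Function.comp, hrel x (by simpa using hx)]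
      ring))
    linear_combination -h3
  obtain rfl : cp = cm := by exact_mod_cast hc
  have hC_eq : (C : ℂ) = f 0 + Gp 0 - Gm 0 := by
    refine tendsto_nhds_unique (hFf_pole.comp hlim)
      (((hup.tendsto_nhdsGT_zero.const_add (f 0 : ℂ)).sub hum.tendsto_nhdsGT_zero).congr' ?_)
    filter_upwards [self_mem_nhdsWithin] with x hx
    have hx' : 0 < (x : ℂ).re := by simpa using hx
    simp only [Function.comp, hrel x hx', hFp x hx', hFm x hx']
    ring
  have hC_re : C = f 0 + ((Gp 0).re - (Gm 0).re) := by
    have := congrArg Complex.re hC_eq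
    simpa [add_sub_assoc] using this
  rw [hC_re]
  refine (((tendsto_integral_sub_const hP_nonneg hup hU_open hU_halfplane hGp).sub
    (tendsto_integral_sub_const hM_nonneg hum hU_open hU_halfplane hGm)).const_add
    (f 0)).congr' ?_
  filter_upwards [eventually_ge_atTop 0] with T hT
  have hiP := hup.intervalIntegrable le_rfl hT
  have hiM := hum.intervalIntegrable le_rfl hT
  rw [← intervalIntegral.integral_sub hiP hiM]
  simp only [sub_sub_sub_cancel_right]
  rw [intervalIntegral.integral_eq_sub_of_hasDerivAt
    (fun t ht => hderiv t ((le_min le_rfl hT).trans ht.1))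
    (by simpa using! hiP.sub hiM)]
  ring
end
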